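/- arXiv:1506.07019 — 3 statements merged into one kernel-verified Lean document; each statement's English description precedes it below -/
import Mathlib

section
/- (Landau) For all a₀ ∈ ℂ \ {0,1} and a₁ ∈ ℂ with a₁ ≠ 0 there exists a constant C > 0, depending only on a₀ and a₁, such that: for every r > 0 and every holomorphic function f on the disc {z ∈ ℂ : |z| < r} with f(z) ≠ 0 and f(z) ≠ 1 for all z, f(0) = a₀ and f'(0) = a₁, one has r ≤ C. -/
open Metric Set

theorem bloch_aux {f : ℂ → ℂ} {r R : ℝ} (hR : 0 < R) (hRr : R < r)
    (hf : DifferentiableOn ℂ f (ball 0 r)) :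
    ∃ p : ℂ, ball p (R * ‖deriv f 0‖ / 48) ⊆ f '' ball 0 r := by
  have hd : DifferentiableOn ℂ (deriv f) (ball 0 r) := hf.deriv isOpen_ball
  have hsub : closedBall (0:ℂ) R ⊆ ball 0 r := closedBall_subset_ball hRr
  have hcont : ContinuousOn (fun z : ℂ => ‖deriv f z‖ * (R - ‖z‖)) (closedBall 0 R) :=
    ((hd.continuousOn.mono hsub).norm).mul (by fun_prop)
  obtain ⟨p, hp, hmax⟩ := (isCompact_closedBall (0:ℂ) R).exists_isMaxOn
    ⟨0, by simp [hR.le]⟩ hcont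
  have hmax' : ∀ z : ℂ, ‖z‖ ≤ R → ‖deriv f z‖ * (R - ‖z‖) ≤ ‖deriv f p‖ * (R - ‖p‖) :=
    fun z hz => hmax (by simpa using hz)
  have h0 : ‖deriv f 0‖ * R ≤ ‖deriv f p‖ * (R - ‖p‖) := by
    simpa using hmax' 0 (by simp [hR.le])
  rcases eq_or_ne (deriv f 0) 0 with hz | hz
  · exact ⟨0, by simp [hz]⟩
  have hpos : 0 < ‖deriv f 0‖ * R := mul_pos (norm_pos_iff.2 hz) hR
  have hpR : ‖p‖ ≤ R := by simpa using hp
  have hprod : 0 < ‖deriv f p‖ * (R - ‖p‖) := hpos.trans_le h0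
  have hdp : 0 < ‖deriv f p‖ := by
    rcases (norm_nonneg (deriv f p)).eq_or_lt with h | h
    · rw [← h] at hprod; simp at hprod
    · exact h
  have hgap : 0 < R - ‖p‖ := (pos_iff_pos_of_mul_pos hprod).1 hdp
  set t := (R - ‖p‖) / 2 with ht
  have htpos : 0 < t := by positivity
  have hnorm : ∀ z ∈ ball p t, ‖z‖ < ‖p‖ + t := fun z hz => by
    have h1 : ‖z - p‖ < t := by simpa [dist_eq_norm] using hz
    have := norm_add_le (z - p) p
    rw [sub_add_cancel] at this
    linarith
  have hbt : ball p t ⊆ ball 0 r := fun z hz => by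
    have := hnorm z hz
    rw [mem_ball_zero_iff]; linarith
  have hbound : ∀ z ∈ ball p t, ‖deriv f z‖ ≤ 2 * ‖deriv f p‖ := fun z hz => by
    have h1 := hnorm z hz
    have h2 := hmax' z (by linarith)
    have h3 : ‖deriv f z‖ * t ≤ ‖deriv f z‖ * (R - ‖z‖) :=
      mul_le_mul_of_nonneg_left (by linarith) (norm_nonneg _)
    have h4 : R - ‖p‖ = 2 * t := by rw [ht]; ring
    rw [h4] at h2
    have : ‖deriv f z‖ * t ≤ (2 * ‖deriv f p‖) * t := by linarith
    exact le_of_mul_le_mul_right this htpos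
  have hmaps : MapsTo (deriv f) (ball p t) (closedBall (deriv f p) (3 * ‖deriv f p‖)) := by
    intro z hz
    rw [mem_closedBall, dist_eq_norm]
    have := norm_sub_le (deriv f z) (deriv f p)
    have := hbound z hz
    linarith
  have hsch : ∀ z ∈ closedBall p (t/6), ‖deriv f z - deriv f p‖ ≤ ‖deriv f p‖ / 2 := by
    intro z hz
    have hz' : dist z p ≤ t / 6 := hz
    have h1 := Complex.dist_le_div_mul_dist_of_mapsTo_ball (hd.mono hbt) hmaps
      (z := z) (by rw [mem_ball]; linarith)
    rw [← dist_eq_norm]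
    refine h1.trans ((mul_le_mul_of_nonneg_left hz' (by positivity)).trans_eq ?_)
    field_simp; norm_num
  have hsub6 : closedBall p (t/6) ⊆ ball p t := closedBall_subset_ball (by linarith)
  have hmv : ∀ z ∈ closedBall p (t/6), ‖f z - f p - deriv f p * (z - p)‖
      ≤ ‖deriv f p‖ / 2 * ‖z - p‖ := by
    intro z hz
    have := (convex_closedBall p (t/6)).norm_image_sub_le_of_norm_hasDerivWithin_le
      (f := fun z => f z - deriv f p * z) (f' := fun z => deriv f z - deriv f p)
      (C := ‖deriv f p‖ / 2) (x := p) (y := z) (fun w hw => by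
        have hw' : HasDerivAt f (deriv f w) w :=
          (hf.differentiableAt (isOpen_ball.mem_nhds (hbt (hsub6 hw)))).hasDerivAt
        have := hw'.fun_sub ((hasDerivAt_id w).const_mul (deriv f p))
        simpa using this.hasDerivWithinAt) hsch
      (mem_closedBall_self (by positivity)) hz
    rw [show f z - f p - deriv f p * (z - p) =
      (f z - deriv f p * z) - (f p - deriv f p * p) by ring]
    exact this
  have hlow : ∀ z ∈ closedBall p (t/6), ‖deriv f p‖ / 2 * ‖z - p‖ ≤ ‖f z - f p‖ := by
    intro z hz
    have h1 := hmv z hz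
    have h2 : ‖deriv f p * (z - p)‖ ≤ ‖f z - f p‖ + ‖f z - f p - deriv f p * (z - p)‖ := by
      rw [show deriv f p * (z - p) = (f z - f p) - (f z - f p - deriv f p * (z - p)) by ring]
      refine (norm_sub_le _ _).trans ?_
      simp
    rw [norm_mul] at h2
    linarith
  have hdc : DiffContOnCl ℂ f (ball p (t/6)) := by
    refine DifferentiableOn.diffContOnCl ?_
    exact hf.mono ((closure_ball_subset_closedBall.trans hsub6).trans hbt)
  have himg := hdc.ball_subset_image_closedBall (ε := ‖deriv f p‖ / 2 * (t/6)) (by positivity)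
    (fun z hz => by
      have h1 := hlow z (sphere_subset_closedBall hz)
      have h2 : ‖z - p‖ = t / 6 := by simpa [dist_eq_norm] using hz
      rwa [h2] at h1) (by
      have hev : ∀ᶠ z in nhdsWithin p {p}ᶜ, f z ≠ f p := by
        filter_upwards [self_mem_nhdsWithin,
          mem_nhdsWithin_of_mem_nhds (closedBall_mem_nhds p (show 0 < t/6 by positivity))]
          with z hz hz2 heq
        have h1 := hlow z hz2
        rw [heq, sub_self, norm_zero] at h1
        have : 0 < ‖z - p‖ := norm_pos_iff.2 (sub_ne_zero.2 hz)
        have : 0 < ‖deriv f p‖ / 2 * ‖z - p‖ := by positivity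
        linarith
      exact hev.frequently.filter_mono nhdsWithin_le_nhds)
  refine ⟨f p, (ball_subset_ball ?_).trans (himg.trans (image_mono (hsub6.trans hbt)))⟩
  rw [ht]; linarith

theorem exists_log_ball {f : ℂ → ℂ} {r : ℝ} (hr : 0 < r) (hf : DifferentiableOn ℂ f (ball 0 r))
    (h0 : ∀ z ∈ ball (0:ℂ) r, f z ≠ 0) (w : ℂ) (hw : Complex.exp w = f 0) :
    ∃ g : ℂ → ℂ, g 0 = w ∧ DifferentiableOn ℂ g (ball 0 r) ∧
      ∀ z ∈ ball (0:ℂ) r, Complex.exp (g z) = f z := by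
  have hd : DifferentiableOn ℂ (fun z => deriv f z / f z) (ball 0 r) :=
    (hf.deriv isOpen_ball).div hf h0
  obtain ⟨g, hg0, hg⟩ := hd.isExactOn_ball.with_val_at 0 w
  refine ⟨g, hg0, fun z hz => (hg z hz).differentiableAt.differentiableWithinAt, ?_⟩
  have hder : ∀ z ∈ ball (0:ℂ) r, HasDerivAt (fun z => f z * Complex.exp (-g z)) 0 z := by
    intro z hz
    have h1 : HasDerivAt f (deriv f z) z :=
      (hf.differentiableAt (isOpen_ball.mem_nhds hz)).hasDerivAt
    have h2 := h1.fun_mul (hg z hz).fun_neg.cexp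
    refine h2.congr_deriv ?_
    have := h0 z hz
    field_simp; ring
  intro z hz
  have h0m : (0:ℂ) ∈ ball (0:ℂ) r := mem_ball_self hr
  have := (convex_ball (0:ℂ) r).norm_image_sub_le_of_norm_hasDerivWithin_le (C := 0)
    (fun w hw => (hder w hw).hasDerivWithinAt) (by simp) h0m hz
  rw [zero_mul] at this
  have h := sub_eq_zero.1 (norm_le_zero_iff.1 this)
  simp only [hg0, ← hw, Complex.exp_neg] at h
  have e1 := Complex.exp_ne_zero w
  have e2 := Complex.exp_ne_zero (g z)
  field_simp at h
  exact h.symm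

theorem exists_cosh_odd_nonneg (x : ℝ) (hx : 0 ≤ x) :
    ∃ y : ℝ, ∃ k : ℤ, |y - x| ≤ 3 ∧ Real.cosh y = 2 * k + 1 := by
  have h1 : Real.cosh x + 2 ≤ Real.cosh (x + 3) := by
    rw [Real.cosh_eq, Real.cosh_eq, Real.exp_add]
    have e1 : 1 ≤ Real.exp x := Real.one_le_exp hx
    have e2 : Real.exp (-x) ≤ 1 := Real.exp_le_one_iff.2 (by linarith)
    have e3 : 8 ≤ Real.exp 3 := by
      have : (2:ℝ) ≤ Real.exp 1 := by linarith [Real.add_one_le_exp (1:ℝ)]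
      have h : Real.exp 3 = Real.exp 1 ^ 3 := by rw [← Real.exp_nat_mul]; norm_num
      rw [h]
      calc (8:ℝ) = 2 ^ 3 := by norm_num
        _ ≤ _ := by gcongr
    have e4 := Real.exp_pos (-(x+3))
    nlinarith
  set k : ℤ := ⌈(Real.cosh x - 1) / 2⌉
  have k1 : (Real.cosh x - 1) / 2 ≤ k := Int.le_ceil _
  have k2 : (k:ℝ) < (Real.cosh x - 1) / 2 + 1 := Int.ceil_lt_add_one _
  obtain ⟨y, hy, hyk⟩ := intermediate_value_Icc (show x ≤ x + 3 by linarith)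
    Real.continuous_cosh.continuousOn (show (2 * k + 1 : ℝ) ∈ _ from ⟨by linarith, by linarith⟩)
  exact ⟨y, k, abs_le.2 ⟨by linarith [hy.1], by linarith [hy.2]⟩, hyk⟩

theorem exists_cosh_odd (x : ℝ) :
    ∃ y : ℝ, ∃ k : ℤ, |y - x| ≤ 3 ∧ Real.cosh y = 2 * k + 1 := by
  rcases le_total 0 x with h | h
  · exact exists_cosh_odd_nonneg x h
  · obtain ⟨y, k, h1, h2⟩ := exists_cosh_odd_nonneg (-x) (by linarith)
    refine ⟨-y, k, ?_, by rwa [Real.cosh_neg]⟩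
    rw [← abs_neg]; convert h1 using 2; ring

theorem exists_cosh_odd_complex (c : ℂ) :
    ∃ w : ℂ, ∃ k : ℤ, w ∈ ball c 8 ∧ Complex.cosh w = 2 * k + 1 := by
  obtain ⟨y, k, h1, h2⟩ := exists_cosh_odd c.re
  set m : ℤ := round (c.im / (2 * Real.pi))
  have hm : |c.im / (2 * Real.pi) - m| ≤ 1 / 2 := abs_sub_round _
  have hpi := Real.pi_pos
  have hm' : |(m:ℝ) * (2 * Real.pi) - c.im| ≤ Real.pi := by
    have : (m:ℝ) * (2 * Real.pi) - c.im = -(c.im / (2 * Real.pi) - m) * (2 * Real.pi) := by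
      field_simp; ring
    rw [this, abs_mul, abs_neg, abs_of_pos (by positivity : 0 < 2 * Real.pi)]
    nlinarith
  refine ⟨y + m * (2 * Real.pi * Complex.I), k, ?_, ?_⟩
  · rw [mem_ball, dist_eq_norm]
    refine (Complex.norm_le_abs_re_add_abs_im _).trans_lt ?_
    have := Real.pi_lt_four
    simp
    linarith
  · have e : Complex.exp (m * (2 * Real.pi * Complex.I)) = 1 := Complex.exp_int_mul_two_pi_mul_I m
    rw [Complex.cosh, neg_add, Complex.exp_add, Complex.exp_add, Complex.exp_neg (m * _), e,
      inv_one, mul_one, mul_one, ← Complex.cosh, ← Complex.ofReal_cosh, h2]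
    push_cast; ring

theorem exp_pi_odd (k : ℤ) : Complex.exp (Real.pi * Complex.I * (2 * k + 1)) = -1 := by
  rw [show Real.pi * Complex.I * (2 * k + 1) = k * (2 * Real.pi * Complex.I) + Real.pi * Complex.I
    by ring, Complex.exp_add, Complex.exp_int_mul_two_pi_mul_I, Complex.exp_pi_mul_I, one_mul]

theorem landau_radius_bound (a₀ : ℂ) (ha₀ : a₀ ≠ 0 ∧ a₀ ≠ 1) (a₁ : ℂ) (ha₁ : a₁ ≠ 0) :
    ∃ C : ℝ, 0 < C ∧ ∀ r : ℝ, 0 < r → ∀ f : ℂ → ℂ,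
      DifferentiableOn ℂ f (Metric.ball 0 r) →
      (∀ z ∈ Metric.ball (0 : ℂ) r, f z ≠ 0 ∧ f z ≠ 1) →
      f 0 = a₀ → deriv f 0 = a₁ → r ≤ C := by
  have hpi : (Real.pi : ℂ) * Complex.I ≠ 0 :=
    mul_ne_zero (Complex.ofReal_ne_zero.2 Real.pi_ne_zero) Complex.I_ne_zero
  set W₀ : ℂ := Complex.log (-a₀) / (Real.pi * Complex.I) with hW₀
  have hexpW₀ : Complex.exp (Real.pi * Complex.I * W₀) = -a₀ := by
    rw [hW₀, mul_div_cancel₀ _ hpi, Complex.exp_log (neg_ne_zero.2 ha₀.1)]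
  have hodd : ∀ (b W : ℂ), b ≠ 1 → Complex.exp (Real.pi * Complex.I * W) = -b →
      ∀ k : ℤ, W ≠ 2 * k + 1 := by
    rintro b W hb hW k rfl
    rw [exp_pi_odd] at hW
    exact hb (neg_injective hW).symm
  have hsqne : ∀ (b W : ℂ), b ≠ 1 → Complex.exp (Real.pi * Complex.I * W) = -b →
      W ^ 2 - 1 ≠ 0 := by
    intro b W hb hW h
    have h1 := hodd b W hb hW 0
    have h2 := hodd b W hb hW (-1)
    have : (W - 1) * (W + 1) = 0 := by linear_combination h
    rcases mul_eq_zero.1 this with h | h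
    · exact h1 (by push_cast; linear_combination h)
    · exact h2 (by push_cast; linear_combination h)
  set Q : ℂ := (a₁ / (a₀ * (Real.pi * Complex.I))) ^ 2 / (W₀ ^ 2 - 1) with hQ
  have hsq0 := hsqne a₀ W₀ ha₀.2 hexpW₀
  have hQ0 : Q ≠ 0 := div_ne_zero (pow_ne_zero _ (div_ne_zero ha₁ (mul_ne_zero ha₀.1 hpi))) hsq0
  set q := Real.sqrt ‖Q‖
  have hq : 0 < q := Real.sqrt_pos.2 (norm_pos_iff.2 hQ0)
  refine ⟨384 / q, by positivity, ?_⟩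
  intro r hr f hf hom hf0 hf1
  have h0m : (0:ℂ) ∈ ball (0:ℂ) r := mem_ball_self hr
  -- first logarithm
  obtain ⟨L, hL0, hLd, hL⟩ := exists_log_ball hr hf.neg (fun z hz => neg_ne_zero.2 (hom z hz).1)
    (Real.pi * Complex.I * W₀) (by rw [hexpW₀]; simp [hf0])
  set W : ℂ → ℂ := fun z => L z / (Real.pi * Complex.I) with hWdef
  have hWd : DifferentiableOn ℂ W (ball 0 r) := hLd.div_const _
  have hW0 : W 0 = W₀ := by simp only [hWdef, hL0]; rw [mul_div_cancel_left₀ _ hpi]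
  have hWexp : ∀ z ∈ ball (0:ℂ) r, Complex.exp (Real.pi * Complex.I * W z) = -f z := by
    intro z hz
    simp only [hWdef]
    rw [mul_div_cancel₀ _ hpi, hL z hz]; rfl
  -- square root
  have hSd0 : DifferentiableOn ℂ (fun z => W z ^ 2 - 1) (ball 0 r) := (hWd.pow 2).sub_const 1
  obtain ⟨M, -, hMd, hM⟩ := exists_log_ball hr hSd0
    (fun z hz => hsqne (f z) (W z) (hom z hz).2 (hWexp z hz))
    (Complex.log (W 0 ^ 2 - 1)) (Complex.exp_log
      (hsqne (f 0) (W 0) (hom 0 h0m).2 (hWexp 0 h0m)))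
  set S : ℂ → ℂ := fun z => Complex.exp (M z / 2) with hSdef
  have hSd : DifferentiableOn ℂ S (ball 0 r) := (hMd.div_const 2).cexp
  have hS : ∀ z ∈ ball (0:ℂ) r, S z ^ 2 = W z ^ 2 - 1 := by
    intro z hz
    rw [← hM z hz]
    simp only [hSdef]
    rw [← Complex.exp_nat_mul]; congr 1; push_cast; ring
  have hne : ∀ z ∈ ball (0:ℂ) r, W z + S z ≠ 0 := by
    intro z hz h
    have : (W z + S z) * (W z - S z) = 1 := by linear_combination -hS z hz
    rw [h, zero_mul] at this
    exact zero_ne_one this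
  -- second logarithm
  obtain ⟨G, -, hGd, hG⟩ := exists_log_ball hr (hWd.add hSd) hne
    (Complex.log (W 0 + S 0)) (Complex.exp_log (hne 0 h0m))
  have hG : ∀ z ∈ ball (0:ℂ) r, Complex.exp (G z) = W z + S z := hG
  have hGn : ∀ z ∈ ball (0:ℂ) r, Complex.exp (-G z) = W z - S z := by
    intro z hz
    rw [Complex.exp_neg, hG z hz]
    refine inv_eq_of_mul_eq_one_right ?_
    linear_combination -hS z hz
  have hcosh : ∀ z ∈ ball (0:ℂ) r, Complex.cosh (G z) = W z := by
    intro z hz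
    rw [Complex.cosh, hG z hz, hGn z hz]; ring
  have hsinh : ∀ z ∈ ball (0:ℂ) r, Complex.sinh (G z) = S z := by
    intro z hz
    rw [Complex.sinh, hG z hz, hGn z hz]; ring
  have hfG : ∀ z ∈ ball (0:ℂ) r,
      f z = -Complex.exp (Real.pi * Complex.I * Complex.cosh (G z)) := by
    intro z hz
    rw [hcosh z hz, hWexp z hz, neg_neg]
  -- derivative at zero
  have hG' : HasDerivAt G (deriv G 0) 0 :=
    (hGd.differentiableAt (isOpen_ball.mem_nhds h0m)).hasDerivAt
  have hfd := ((hG'.ccosh.const_mul (Real.pi * Complex.I)).cexp).fun_neg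
  have hfd2 := hfd.congr_of_eventuallyEq (f₁ := f)
    (Filter.eventuallyEq_of_mem (isOpen_ball.mem_nhds h0m) hfG)
  have hd := hfd2.deriv
  rw [hf1, hcosh 0 h0m, hsinh 0 h0m, hWexp 0 h0m, hf0] at hd
  have hS0 := hS 0 h0m
  rw [hW0] at hS0
  have hQG : deriv G 0 ^ 2 = Q := by
    rw [hQ, ← hS0, hd]
    have h1 : S 0 ≠ 0 := Complex.exp_ne_zero _
    have h2 := ha₀.1
    have h3 := Complex.I_ne_zero
    have h4 : (Real.pi : ℂ) ≠ 0 := Complex.ofReal_ne_zero.2 Real.pi_ne_zero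
    field_simp
  have hGq : ‖deriv G 0‖ = q := by
    simp only [q]
    rw [← hQG, norm_pow, Real.sqrt_sq (norm_nonneg _)]
  -- conclusion
  refine le_of_forall_lt fun R hRr => ?_
  rcases le_or_gt R 0 with hR | hR
  · exact hR.trans_lt (by positivity)
  obtain ⟨p, hp⟩ := bloch_aux hR hRr hGd
  rw [hGq] at hp
  rw [lt_div_iff₀ hq]
  by_contra! hcon
  obtain ⟨w, k, hw, hwk⟩ := exists_cosh_odd_complex p
  obtain ⟨z, hz, rfl⟩ := hp (ball_subset_ball (by linarith) hw)
  exact hodd (f z) (W z) (hom z hz).2 (hWexp z hz) k (by rw [← hcosh z hz, hwk])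
end

section
/- (Little Picard theorem) Let f : ℂ → ℂ be an entire function and suppose there exist a, b ∈ ℂ with a ≠ b such that f(z) ≠ a and f(z) ≠ b for all z ∈ ℂ. Then f is constant. -/
open Complex Metric Set Filter Topology

/-- A nonvanishing entire function has an entire logarithm. -/
lemma entire_log (g : ℂ → ℂ) (hg : Differentiable ℂ g) (h0 : ∀ z, g z ≠ 0) :
    ∃ F : ℂ → ℂ, Differentiable ℂ F ∧ ∀ z, g z = exp (F z) := by
  have hg' : Differentiable ℂ (deriv g) := by
    intro z
    exact (hg.analyticAt z).deriv.differentiableAt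
  have hq : Differentiable ℂ (fun z => deriv g z / g z) := hg'.div hg h0
  obtain ⟨F, hF0, hF⟩ := hq.isExactOn_univ.with_val_at 0 (log (g 0))
  have hF' : ∀ z, HasDerivAt F (deriv g z / g z) z := fun z => hF z (mem_univ z)
  refine ⟨F, fun z => (hF' z).differentiableAt, fun z => ?_⟩
  have hd : ∀ z, HasDerivAt (fun z => g z * exp (-F z)) 0 z := by
    intro z
    have h1 := (hg z).hasDerivAt.mul ((hF' z).neg.cexp)
    refine h1.congr_deriv ?_
    have := h0 z
    simp only [Pi.neg_apply]
    field_simp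
    ring
  have hc := is_const_of_deriv_eq_zero (fun z => (hd z).differentiableAt)
    (fun z => (hd z).deriv) z 0
  simp only [hF0, exp_neg, exp_log (h0 0)] at hc
  rw [mul_inv_cancel₀ (h0 0)] at hc
  exact eq_of_mul_inv_eq_one hc

/-- An entire function omitting `1` and `-1` is `cos (π G)` with `G` entire. -/
lemma entire_arccos (h : ℂ → ℂ) (hh : Differentiable ℂ h) (h1 : ∀ z, h z ≠ 1)
    (h2 : ∀ z, h z ≠ -1) :
    ∃ G : ℂ → ℂ, Differentiable ℂ G ∧ ∀ z, h z = cos (Real.pi * G z) := by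
  obtain ⟨L, hL, hL'⟩ := entire_log (fun z => h z ^ 2 - 1) (by fun_prop) (by
    intro z hz
    have : (h z - 1) * (h z + 1) = 0 := by linear_combination hz
    rcases mul_eq_zero.1 this with h' | h'
    · exact h1 z (by linear_combination h')
    · exact h2 z (by linear_combination h'))
  set s : ℂ → ℂ := fun z => exp (L z / 2) with hs
  have hsd : Differentiable ℂ s := by fun_prop
  have hs2 : ∀ z, s z ^ 2 = h z ^ 2 - 1 := by
    intro z
    rw [hL' z, hs]
    simp only
    rw [← exp_nat_mul]
    congr 1
    push_cast
    ring
  have hprod : ∀ z, (h z + s z) * (h z - s z) = 1 := by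
    intro z
    linear_combination - hs2 z
  obtain ⟨F, hF, hF'⟩ := entire_log (fun z => h z + s z) (by fun_prop) (by
    intro z hz
    have := hprod z
    rw [hz] at this
    simp at this)
  have hpi : (Real.pi : ℂ) ≠ 0 := by exact_mod_cast Real.pi_ne_zero
  refine ⟨fun z => F z / (Real.pi * I), by fun_prop, fun z => ?_⟩
  have e1 : (Real.pi : ℂ) * (F z / (Real.pi * I)) * I = F z := by
    field_simp
  have e2 : exp (-F z) = h z - s z := by
    have := hprod z
    rw [exp_neg, ← hF' z]
    exact (eq_inv_of_mul_eq_one_right this).symm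
  rw [cos, neg_mul, e1, e2, ← hF' z]
  ring

/-- If the derivative is at most twice its value at the centre, the image contains a disc. -/
lemma bloch_aux_s16 (f : ℂ → ℂ) (hf : Differentiable ℂ f) (a : ℂ) (r : ℝ) (hr : 0 < r)
    (h0 : deriv f a ≠ 0) (hb : ∀ z ∈ ball a r, ‖deriv f z‖ ≤ 2 * ‖deriv f a‖) :
    ball (f a) (‖deriv f a‖ * r / 64) ⊆ range f := by
  have hf' : Differentiable ℂ (deriv f) := by
    intro z
    exact (hf.analyticAt z).deriv.differentiableAt
  set m := ‖deriv f a‖ with hm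
  have hmpos : 0 < m := norm_pos_iff.2 h0
  have h2 : ∀ z ∈ ball a (r / 2), ‖deriv (deriv f) z‖ ≤ 8 * m / r := by
    intro z hz
    have := norm_deriv_le_of_forall_mem_sphere_norm_le (f := deriv f) (c := z) (R := r / 4)
      (C := 2 * m) (by positivity) hf'.diffContOnCl (by
        intro w hw
        apply hb
        rw [mem_ball] at *
        rw [mem_sphere] at hw
        linarith [dist_triangle w z a])
    refine this.trans (le_of_eq ?_)
    field_simp
    ring
  have h3 : ∀ z ∈ closedBall a (r / 16), ‖deriv f z - deriv f a‖ ≤ m / 2 := by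
    intro z hz
    rw [mem_closedBall] at hz
    have := (convex_ball a (r / 2)).norm_image_sub_le_of_norm_deriv_le (𝕜 := ℂ)
      (fun x _ => hf' x) h2 (mem_ball_self (by positivity))
      (show z ∈ ball a (r / 2) by rw [mem_ball]; linarith)
    rw [← dist_eq_norm z a] at this
    refine this.trans ?_
    calc 8 * m / r * dist z a ≤ 8 * m / r * (r / 16) := by gcongr
      _ = m / 2 := by field_simp; ring
  have h4 : ∀ z ∈ sphere a (r / 16), m * r / 32 ≤ ‖f z - f a‖ := by
    intro z hz
    have hd : ∀ x, HasDerivAt (fun z => f z - deriv f a * z) (deriv f x - deriv f a) x := by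
      intro x
      exact ((hf x).hasDerivAt.sub ((hasDerivAt_id x).const_mul (deriv f a))).congr_deriv (by simp)
    have := (convex_closedBall a (r / 16)).norm_image_sub_le_of_norm_hasDerivWithin_le (𝕜 := ℂ)
      (fun x _ => (hd x).hasDerivWithinAt) h3 (mem_closedBall_self (by positivity))
      (sphere_subset_closedBall hz)
    rw [mem_sphere, dist_eq_norm] at hz
    rw [hz] at this
    have e : deriv f a * (z - a) = (f z - f a) -
      ((f z - deriv f a * z) - (f a - deriv f a * a)) := by ring
    have e' : m * (r / 16) ≤ ‖f z - f a‖ + m / 2 * (r / 16) := by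
      calc m * (r / 16) = ‖deriv f a * (z - a)‖ := by rw [norm_mul, hz]
        _ ≤ ‖f z - f a‖ + ‖(f z - deriv f a * z) - (f a - deriv f a * a)‖ := by
          rw [e]; exact norm_sub_le _ _
        _ ≤ _ := by gcongr
    linarith
  have h5 := DiffContOnCl.ball_subset_image_closedBall (f := f) (z₀ := a) (r := r / 16)
    hf.diffContOnCl (by positivity) h4 (by
      have := (hf a).hasDerivAt.eventually_ne (c := f a) h0
      exact this.frequently.filter_mono nhdsWithin_le_nhds)
  refine Subset.trans ?_ (h5.trans (image_subset_range _ _))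
  apply ball_subset_ball
  linarith

/-- Bloch: the image of a nonconstant entire function contains arbitrarily large discs. -/
lemma bloch_entire (f : ℂ → ℂ) (hf : Differentiable ℂ f) (z₀ : ℂ) (h0 : deriv f z₀ ≠ 0)
    (M : ℝ) (hM : 0 < M) : ∃ w, ball w M ⊆ range f := by
  have hf' : Differentiable ℂ (deriv f) := by
    intro z
    exact (hf.analyticAt z).deriv.differentiableAt
  have hpos : 0 < ‖deriv f z₀‖ := norm_pos_iff.2 h0
  set R : ℝ := 128 * M / ‖deriv f z₀‖ with hR
  have hRpos : 0 < R := by positivity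
  have hc : Continuous (fun z => ‖deriv f z‖ * (R - dist z z₀)) := by
    have := hf'.continuous
    fun_prop
  obtain ⟨p, hp, hmax⟩ := (isCompact_closedBall z₀ R).exists_isMaxOn
    ⟨z₀, mem_closedBall_self hRpos.le⟩ hc.continuousOn
  have hmax' : ∀ z ∈ closedBall z₀ R,
    ‖deriv f z‖ * (R - dist z z₀) ≤ ‖deriv f p‖ * (R - dist p z₀) := fun z hz => hmax hz
  have hz := hmax' z₀ (mem_closedBall_self hRpos.le)
  rw [dist_self, sub_zero] at hz
  have hRe : ‖deriv f z₀‖ * R = 128 * M := by rw [hR]; field_simp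
  rw [hRe] at hz
  rw [mem_closedBall] at hp
  have hprod : 0 < ‖deriv f p‖ * (R - dist p z₀) := by linarith
  have hdp : 0 < ‖deriv f p‖ := by
    rcases (norm_nonneg (deriv f p)).eq_or_lt with h | h
    · rw [← h] at hprod; simp at hprod
    · exact h
  have ht : 0 < R - dist p z₀ := by
    by_contra hcon
    nlinarith
  refine ⟨f p, Subset.trans (ball_subset_ball ?_)
    (bloch_aux_s16 f hf p ((R - dist p z₀) / 2) (by linarith) (norm_pos_iff.1 hdp) ?_)⟩
  · linarith
  · intro z hz
    rw [mem_ball] at hz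
    have htri := dist_triangle z p z₀
    have h1 := hmax' z (by rw [mem_closedBall]; linarith)
    have h2 : ‖deriv f z‖ * ((R - dist p z₀) / 2) ≤ ‖deriv f z‖ * (R - dist z z₀) := by
      gcongr
      linarith
    have h3 : ‖deriv f z‖ * (R - dist p z₀) ≤ 2 * ‖deriv f p‖ * (R - dist p z₀) := by linarith
    exact le_of_mul_le_mul_right h3 ht

/-- Near every point there is a point where `cos (π a)` is an integer. -/
lemma exists_cos_int (w : ℂ) : ∃ a ∈ ball w 2, ∃ n : ℤ, cos (Real.pi * a) = n := by
  have hpi := Real.pi_gt_three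
  have key : ∀ y : ℝ, 0 ≤ y → ∃ t ∈ Icc y (y + 1), ∃ n : ℤ, Real.cosh (Real.pi * t) = n := by
    intro y hy
    have hcont : ContinuousOn (fun t => Real.cosh (Real.pi * t)) (Icc y (y + 1)) := by
      have := Real.continuous_cosh
      fun_prop
    have hsub := intermediate_value_Icc (by linarith) hcont
    have h1 : Real.cosh (Real.pi * y) + 1 ≤ Real.cosh (Real.pi * (y + 1)) := by
      rw [mul_add, mul_one, Real.cosh_add]
      have a1 := Real.one_le_cosh (Real.pi * y)
      have a2 : 0 ≤ Real.sinh (Real.pi * y) := Real.sinh_nonneg_iff.2 (by positivity)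
      have a3 : 3 < Real.sinh Real.pi := hpi.trans (Real.self_lt_sinh_iff.2 Real.pi_pos)
      have a4 := Real.sinh_lt_cosh Real.pi
      nlinarith
    have hmem : ((⌈Real.cosh (Real.pi * y)⌉ : ℤ) : ℝ) ∈
        Icc (Real.cosh (Real.pi * y)) (Real.cosh (Real.pi * (y + 1))) :=
      ⟨Int.le_ceil _, (Int.ceil_lt_add_one _).le.trans h1⟩
    obtain ⟨t, ht, hte⟩ := hsub hmem
    exact ⟨t, ht, _, hte⟩
  have key2 : ∃ t : ℝ, |t - w.im| ≤ 1 ∧ ∃ n : ℤ, Real.cosh (Real.pi * t) = n := by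
    rcases le_total 0 w.im with h | h
    · obtain ⟨t, ht, n, hn⟩ := key w.im h
      exact ⟨t, by rw [abs_le]; constructor <;> linarith [ht.1, ht.2], n, hn⟩
    · obtain ⟨t, ht, n, hn⟩ := key (-w.im) (by linarith)
      refine ⟨-t, by rw [abs_le]; constructor <;> linarith [ht.1, ht.2], n, ?_⟩
      rw [mul_neg, Real.cosh_neg, hn]
  obtain ⟨t, ht, n, hn⟩ := key2
  set p : ℤ := round w.re with hp
  have s0 : sin ((p : ℂ) * Real.pi) = 0 := Complex.sin_int_mul_pi p
  have c0 : ∃ k : ℤ, cos ((p : ℂ) * Real.pi) = k := by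
    have hsq := sin_sq_add_cos_sq ((p : ℂ) * Real.pi)
    rw [s0] at hsq
    have : (cos ((p : ℂ) * Real.pi) - 1) * (cos ((p : ℂ) * Real.pi) + 1) = 0 := by
      linear_combination hsq
    rcases mul_eq_zero.1 this with h' | h'
    · exact ⟨1, by push_cast; linear_combination h'⟩
    · exact ⟨-1, by push_cast; linear_combination h'⟩
  obtain ⟨k, c0⟩ := c0
  refine ⟨⟨p, t⟩, ?_, k * n, ?_⟩
  · rw [mem_ball, dist_eq_norm]
    refine (norm_le_abs_re_add_abs_im _).trans_lt ?_
    have := abs_sub_round w.re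
    rw [abs_sub_comm] at this
    simp only [sub_re, sub_im]
    linarith
  · have e : (Real.pi : ℂ) * (⟨p, t⟩ : ℂ) = (p * Real.pi : ℂ) + ((Real.pi * t : ℝ) : ℂ) * I := by
      apply Complex.ext <;> simp [mul_comm]
    rw [e, cos_add, cos_mul_I, s0, c0, ← ofReal_cosh, hn]
    push_cast
    ring

/-- **Little Picard theorem.** An entire function omitting two distinct values is
constant. -/
theorem little_picard (f : ℂ → ℂ) (hf : Differentiable ℂ f)
    (a b : ℂ) (hab : a ≠ b) (h : ∀ z : ℂ, f z ≠ a ∧ f z ≠ b) :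
    ∃ c : ℂ, ∀ z : ℂ, f z = c := by
  have hba : b - a ≠ 0 := sub_ne_zero.2 hab.symm
  obtain ⟨G, hG, hG'⟩ := entire_arccos (fun z => 2 * ((f z - a) / (b - a)) - 1) (by fun_prop)
    (by
      intro z hz
      have : (f z - a) / (b - a) = 1 := by linear_combination hz / 2
      rw [div_eq_one_iff_eq hba] at this
      exact (h z).2 (by linear_combination this))
    (by
      intro z hz
      have : (f z - a) / (b - a) = 0 := by linear_combination hz / 2
      rw [div_eq_zero_iff] at this
      rcases this with this | this
      · exact (h z).1 (by linear_combination this)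
      · exact hba this)
  have hfz : ∀ z, f z = a + (b - a) * ((cos (Real.pi * G z) + 1) / 2) := by
    intro z
    rw [← hG' z]
    field_simp
    ring
  have hGint : ∀ z (n : ℤ), G z ≠ n := by
    intro z n hn
    have s0 : sin ((n : ℂ) * Real.pi) = 0 := Complex.sin_int_mul_pi n
    have hsq := sin_sq_add_cos_sq ((n : ℂ) * Real.pi)
    rw [s0] at hsq
    have h1 := hfz z
    rw [hn, mul_comm (Real.pi : ℂ)] at h1
    have : (cos ((n : ℂ) * Real.pi) - 1) * (cos ((n : ℂ) * Real.pi) + 1) = 0 := by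
      linear_combination hsq
    rcases mul_eq_zero.1 this with h' | h'
    · exact (h z).2 (by linear_combination h1 + (b - a) / 2 * h')
    · exact (h z).1 (by linear_combination h1 + (b - a) / 2 * h')
  obtain ⟨g, hg, hg'⟩ := entire_arccos G hG (fun z => by simpa using hGint z 1)
    (fun z => by simpa using hGint z (-1))
  have hd : ∀ z, deriv g z = 0 := by
    intro z
    by_contra hne
    obtain ⟨w, hw⟩ := bloch_entire g hg z hne 2 (by norm_num)
    obtain ⟨p, hp, n, hn⟩ := exists_cos_int w
    obtain ⟨q, rfl⟩ := hw hp
    exact hGint q n ((hg' q).trans hn)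
  refine ⟨f 0, fun z => ?_⟩
  rw [hfz z, hfz 0, hg' z, hg' 0, is_const_of_deriv_eq_zero hg hd z 0]
end

section
/- (Normality theorem / Big Montel theorem) Let Ω ⊆ ℂ be a domain, let a, b ∈ ℂ with a ≠ b, and let (fₙ) be a sequence of holomorphic functions on Ω such that fₙ(z) ≠ a and fₙ(z) ≠ b for all n and all z ∈ Ω. Then either there exist a subsequence (f_{n_k}) and a holomorphic function g on Ω such that f_{n_k} → g uniformly on every compact subset of Ω, or there exists a subsequence (f_{n_k}) that is compactly divergent: for every compact K ⊆ Ω and every compact L ⊆ ℂ there exists N such that f_{n_k}(K) ∩ L = ∅ for all k > N. -/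
open Filter Topology Metric Set

/-- Holomorphic logarithm on a ball. -/
lemma nt_log {f : ℂ → ℂ} {c : ℂ} {R : ℝ} (hf : DifferentiableOn ℂ f (ball c R))
    (h0 : ∀ z ∈ ball c R, f z ≠ 0) :
    ∃ g : ℂ → ℂ, DifferentiableOn ℂ g (ball c R) ∧ ∀ z ∈ ball c R, Complex.exp (g z) = f z := by
  by_cases hR : 0 < R
  swap
  · exact ⟨0, by simp [ball_eq_empty.2 (not_lt.1 hR)], by simp [ball_eq_empty.2 (not_lt.1 hR)]⟩
  have hc : c ∈ ball c R := mem_ball_self hR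
  have hd : DifferentiableOn ℂ (fun z => deriv f z / f z) (ball c R) :=
    (hf.deriv isOpen_ball).div hf h0
  obtain ⟨G, hGc, hG⟩ := hd.isExactOn_ball.with_val_at c (Complex.log (f c))
  refine ⟨G, fun z hz => (hG z hz).differentiableAt.differentiableWithinAt, fun z hz => ?_⟩
  have hder : ∀ w ∈ ball c R, HasDerivAt (fun z => f z * Complex.exp (-G z)) 0 w := by
    intro w hw
    have h1 := (hf.differentiableAt (isOpen_ball.mem_nhds hw)).hasDerivAt
    have h2 := (hG w hw).fun_neg.cexp
    have h3 := h1.fun_mul h2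
    have h5 := h0 w hw
    have h4 : deriv f w * Complex.exp (-G w)
        + f w * (Complex.exp (-G w) * -(deriv f w / f w)) = 0 := by
      field_simp
      ring
    rw [h4] at h3
    exact h3
  have := isOpen_ball.is_const_of_deriv_eq_zero (convex_ball c R).isPreconnected
    (fun w hw => (hder w hw).differentiableAt.differentiableWithinAt)
    (fun w hw => (hder w hw).deriv) hz hc
  simp only [hGc, Complex.exp_neg, Complex.exp_log (h0 c hc)] at this
  rw [mul_inv_cancel₀ (h0 c hc)] at this
  have h4 := Complex.exp_ne_zero (G z)
  field_simp at this
  exact this.symm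

lemma nt_im_le (v : ℂ) : |v.im| ≤ ‖Complex.cos v‖ := by
  have h1 : ‖Complex.cos v‖ ^ 2 = Real.cos v.re ^ 2 + Real.sinh v.im ^ 2 := by
    have h : Complex.cos v = ((Real.cos v.re * Real.cosh v.im : ℝ) : ℂ)
        + ((-(Real.sin v.re * Real.sinh v.im) : ℝ) : ℂ) * Complex.I := by
      rw [Complex.cos_eq]; push_cast; ring
    rw [h, Complex.sq_norm, Complex.normSq_add_mul_I]
    have := Real.cosh_sq v.im
    have h2 := Real.sin_sq_add_cos_sq v.re
    have h3 : Real.sin v.re ^ 2 = 1 - Real.cos v.re ^ 2 := by linarith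
    calc _ = Real.cos v.re ^ 2 * Real.cosh v.im ^ 2
          + Real.sin v.re ^ 2 * Real.sinh v.im ^ 2 := by ring
      _ = _ := by rw [this, h3]; ring
  have h2 : |v.im| ≤ |Real.sinh v.im| := by
    rw [Real.abs_sinh]
    exact Real.self_le_sinh_iff.2 (abs_nonneg _)
  refine h2.trans (abs_le_of_sq_le_sq' ?_ (norm_nonneg _) |> abs_le.2)
  rw [h1]; nlinarith [sq_nonneg (Real.cos v.re)]

lemma nt_shift (x : ℝ) : ∃ k : ℤ, |x - k * (2 * Real.pi)| ≤ Real.pi := by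
  refine ⟨round (x / (2 * Real.pi)), ?_⟩
  have h := abs_sub_round (x / (2 * Real.pi))
  have hp := Real.pi_pos
  have : x - round (x / (2 * Real.pi)) * (2 * Real.pi)
      = (x / (2 * Real.pi) - round (x / (2 * Real.pi))) * (2 * Real.pi) := by
    field_simp
  rw [this, abs_mul, abs_of_pos (by positivity : 0 < 2 * Real.pi)]
  nlinarith

/-- Holomorphic arccosine on a ball, with normalisation at the centre. -/
lemma nt_arccos {F : ℂ → ℂ} {c : ℂ} {R : ℝ} (hF : DifferentiableOn ℂ F (ball c R))
    (h1 : ∀ z ∈ ball c R, F z ≠ 1) (h2 : ∀ z ∈ ball c R, F z ≠ -1) (hR : 0 < R) :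
    ∃ g : ℂ → ℂ, DifferentiableOn ℂ g (ball c R) ∧ (∀ z ∈ ball c R, Complex.cos (g z) = F z) ∧
      ‖g c‖ ≤ Real.pi + ‖F c‖ := by
  obtain ⟨s, hs, hs'⟩ := nt_log (f := fun z => F z ^ 2 - 1) ((hF.pow 2).sub_const 1) (by
    intro z hz h
    have : (F z - 1) * (F z + 1) = 0 := by linear_combination h
    rcases mul_eq_zero.1 this with h | h
    · exact h1 z hz (by linear_combination h)
    · exact h2 z hz (by linear_combination h))
  set q : ℂ → ℂ := fun z => Complex.exp (s z / 2) with hq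
  have hqd : DifferentiableOn ℂ q (ball c R) := (hs.div_const 2).cexp
  have hq2 : ∀ z ∈ ball c R, q z ^ 2 = F z ^ 2 - 1 := by
    intro z hz
    rw [← hs' z hz, hq]
    simp only
    rw [← Complex.exp_nat_mul]
    congr 1; push_cast; ring
  obtain ⟨L, hL, hL'⟩ := nt_log (f := fun z => F z + q z) (hF.add hqd) (by
    intro z hz h
    have := hq2 z hz
    have h3 : q z = - F z := by linear_combination h
    rw [h3] at this
    have h4 : (1 : ℂ) = 0 := by linear_combination this
    exact one_ne_zero h4)
  have hcos : ∀ z ∈ ball c R, Complex.cos (-Complex.I * L z) = F z := by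
    intro z hz
    have h3 := hL' z hz
    have hm : (F z + q z) * (F z - q z) = 1 := by linear_combination -(hq2 z hz)
    have h4 : Complex.exp (-L z) = F z - q z := by
      rw [Complex.exp_neg, h3]
      exact inv_eq_of_mul_eq_one_right hm
    rw [Complex.cos]
    have e1 : -Complex.I * L z * Complex.I = L z := by
      linear_combination (-L z) * Complex.I_mul_I
    have e2 : -(-Complex.I * L z) * Complex.I = -L z := by
      linear_combination (L z) * Complex.I_mul_I
    rw [e1, e2, h3, h4]; ring
  obtain ⟨k, hk⟩ := nt_shift (-Complex.I * L c).re
  have hcos2 : ∀ z ∈ ball c R,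
      Complex.cos (-Complex.I * L z - k * (2 * Real.pi)) = F z := by
    intro z hz
    rw [Complex.cos_sub_int_mul_two_pi, hcos z hz]
  refine ⟨fun z => -Complex.I * L z - k * (2 * Real.pi), (hL.const_mul _).sub_const _, hcos2, ?_⟩
  refine (Complex.norm_le_abs_re_add_abs_im _).trans (add_le_add ?_ ?_)
  · have e : (-Complex.I * L c - k * (2 * Real.pi)).re
        = (-Complex.I * L c).re - k * (2 * Real.pi) := by simp
    exact e ▸ hk
  · refine (nt_im_le _).trans ?_
    rw [hcos2 c (mem_ball_self hR)]

lemma nt_cosh_net (y : ℝ) : ∃ t : ℝ, |t - y| ≤ 2 ∧ ∃ n : ℤ, Real.cosh t = n := by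
  have key : ∀ y : ℝ, 0 ≤ y → ∃ t : ℝ, |t - y| ≤ 2 ∧ ∃ n : ℤ, Real.cosh t = n := by
    intro y hy
    have hgap : Real.cosh y + 1 ≤ Real.cosh (y + 2) := by
      rw [Real.cosh_add]
      have h1 := Real.one_le_cosh y
      have h2 : 2 ≤ Real.cosh 2 := by
        have h3 : (2 : ℝ) ≤ Real.sinh 2 := Real.self_le_sinh_iff.2 (by norm_num)
        nlinarith [Real.cosh_sq 2, Real.one_le_cosh 2]
      have h3 : 0 ≤ Real.sinh y := Real.sinh_nonneg_iff.2 hy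
      have h4 : 0 ≤ Real.sinh 2 := Real.sinh_nonneg_iff.2 (by norm_num)
      nlinarith [mul_nonneg h3 h4]
    have hmem : ((⌈Real.cosh y⌉ : ℤ) : ℝ) ∈ Icc (Real.cosh y) (Real.cosh (y + 2)) :=
      ⟨Int.le_ceil _, by linarith [Int.ceil_lt_add_one (Real.cosh y)]⟩
    obtain ⟨t, ht, hte⟩ := intermediate_value_Icc (by linarith : y ≤ y + 2)
      Real.continuous_cosh.continuousOn hmem
    exact ⟨t, abs_le.2 ⟨by linarith [ht.1], by linarith [ht.2]⟩, _, hte⟩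
  rcases le_total 0 y with h | h
  · exact key y h
  · obtain ⟨t, h1, n, hn⟩ := key (-y) (by linarith)
    refine ⟨-t, ?_, n, by rw [Real.cosh_neg, hn]⟩
    rw [← abs_neg]; convert h1 using 2; ring

lemma nt_net (v : ℂ) : ∃ u ∈ ball v 6, ∃ n : ℤ, Complex.cos u = n := by
  obtain ⟨k, hk⟩ := nt_shift v.re
  obtain ⟨t, ht, n, hn⟩ := nt_cosh_net v.im
  refine ⟨t * Complex.I + k * (2 * Real.pi), ?_, n, ?_⟩
  · rw [mem_ball, dist_eq_norm]
    refine (Complex.norm_le_abs_re_add_abs_im _).trans_lt ?_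
    have e1 : ((t : ℂ) * Complex.I + k * (2 * Real.pi) - v).re = -(v.re - k * (2 * Real.pi)) := by
      simp
    have e2 : ((t : ℂ) * Complex.I + k * (2 * Real.pi) - v).im = t - v.im := by simp
    rw [e1, e2, abs_neg]
    linarith [Real.pi_lt_four]
  · rw [Complex.cos_add_int_mul_two_pi, Complex.cos_mul_I, ← Complex.ofReal_cosh, hn]
    simp

/-- Covering lemma: a Bloch-type estimate. -/
lemma nt_cover {h : ℂ → ℂ} {p : ℂ} {t : ℝ} (ht : 0 < t) (hd : DifferentiableOn ℂ h (ball p t))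
    (hp : deriv h p ≠ 0) (hb : ∀ z ∈ ball p t, ‖deriv h z‖ ≤ 2 * ‖deriv h p‖) :
    ball (h p) (t * ‖deriv h p‖ / 24) ⊆ h '' ball p t := by
  set α := ‖deriv h p‖ with hα
  have hα0 : 0 < α := norm_pos_iff.2 hp
  have hsub : closedBall p (t / 6) ⊆ ball p t := closedBall_subset_ball (by linarith)
  have hdp : DifferentiableAt ℂ h p := hd.differentiableAt (isOpen_ball.mem_nhds (mem_ball_self ht))
  have hS : ∀ z ∈ ball p t, ‖deriv h z - deriv h p‖ ≤ 3 * α / t * dist z p := by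
    intro z hz
    rw [← dist_eq_norm]
    refine Complex.dist_le_div_mul_dist_of_mapsTo_ball (hd.deriv isOpen_ball) ?_ hz
    intro w hw
    rw [mem_closedBall, dist_eq_norm]
    refine (norm_sub_le _ _).trans ?_
    linarith [hb w hw]
  have hE : ∀ z ∈ sphere p (t / 6), t * α / 12 ≤ ‖h z - h p‖ := by
    intro z hz
    have hzd : dist z p = t / 6 := hz
    have hmv := Convex.norm_image_sub_le_of_norm_hasDerivWithin_le (𝕜 := ℂ)
      (f := fun z => h z - deriv h p * z) (f' := fun z => deriv h z - deriv h p)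
      (s := closedBall p (t / 6)) (C := α / 2) (x := p) (y := z) (by
        intro w hw
        have := (hd.differentiableAt (isOpen_ball.mem_nhds (hsub hw))).hasDerivAt
        have h2 := (hasDerivAt_id w).const_mul (deriv h p)
        simpa using (this.fun_sub h2).hasDerivWithinAt) (by
        intro w hw
        refine (hS w (hsub hw)).trans ?_
        rw [mem_closedBall] at hw
        calc 3 * α / t * dist w p ≤ 3 * α / t * (t / 6) := by gcongr
          _ = α / 2 := by field_simp; norm_num) (convex_closedBall _ _)
      (mem_closedBall_self (by linarith)) (sphere_subset_closedBall hz)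
    have e : h z - h p = deriv h p * (z - p) +
      ((h z - deriv h p * z) - (h p - deriv h p * p)) := by ring
    have h3 : ‖deriv h p * (z - p)‖ = α * (t / 6) := by
      rw [norm_mul, ← dist_eq_norm, hzd]
    rw [← dist_eq_norm z p, hzd] at hmv
    have := norm_sub_le_norm_add (deriv h p * (z - p))
      ((h z - deriv h p * z) - (h p - deriv h p * p))
    rw [← e, h3] at this
    linarith
  have hcl : DiffContOnCl ℂ h (ball p (t / 6)) := by
    apply DifferentiableOn.diffContOnCl_ball (U := ball p t) hd hsub
  have hfr : ∃ᶠ z in 𝓝 p, h z ≠ h p :=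
    (hdp.hasDerivAt.eventually_ne (c := h p) hp).frequently.filter_mono nhdsWithin_le_nhds
  have := hcl.ball_subset_image_closedBall (by linarith) hE hfr
  rw [show t * α / 12 / 2 = t * α / 24 by ring] at this
  exact this.trans (image_mono hsub)

/-- Bloch–Landau type derivative estimate for functions whose image contains no large disc. -/
lemma nt_bloch {h : ℂ → ℂ} {c : ℂ} {R ρ : ℝ} (hR : 0 < R) (hρ : 0 < ρ)
    (hd : DifferentiableOn ℂ h (ball c (2 * R)))
    (hno : ∀ w, ¬ ball w ρ ⊆ h '' ball c (2 * R)) :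
    ∀ z ∈ closedBall c R, ‖deriv h z‖ * (R - dist z c) ≤ 48 * ρ := by
  have hsub : closedBall c R ⊆ ball c (2 * R) := closedBall_subset_ball (by linarith)
  have hcont : ContinuousOn (fun z => ‖deriv h z‖ * (R - dist z c)) (closedBall c R) :=
    (((hd.deriv isOpen_ball).continuousOn.mono hsub).norm).mul (by fun_prop)
  obtain ⟨p, hp, hmax⟩ := (isCompact_closedBall c R).exists_isMaxOn
    ⟨c, mem_closedBall_self hR.le⟩ hcont
  intro z hz
  refine (hmax hz).trans ?_
  simp only
  by_contra hlt
  push Not at hlt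
  have hp' : dist p c ≤ R := hp
  have hpos : 0 < ‖deriv h p‖ * (R - dist p c) := by linarith
  have hne : ‖deriv h p‖ ≠ 0 := fun h0 => by simp [h0] at hpos
  have hα : 0 < ‖deriv h p‖ := lt_of_le_of_ne (norm_nonneg _) (Ne.symm hne)
  have ht : 0 < (R - dist p c) / 2 := by
    have := (pos_iff_pos_of_mul_pos hpos).1 hα
    linarith
  set t := (R - dist p c) / 2 with htdef
  have hbs : ball p t ⊆ closedBall c R := by
    intro w hw
    rw [mem_ball] at hw; rw [mem_closedBall]
    linarith [dist_triangle w p c]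
  have hcov := nt_cover ht (hd.mono (hbs.trans hsub)) (norm_ne_zero_iff.1 hne) (by
    intro w hw
    have h1 := hmax (hbs hw)
    simp only [mem_ofPred_eq] at h1
    rw [mem_ball] at hw
    have h2 : t ≤ R - dist w c := by linarith [dist_triangle w p c]
    have h3 : ‖deriv h w‖ * t ≤ 2 * ‖deriv h p‖ * t := by
      calc ‖deriv h w‖ * t ≤ ‖deriv h w‖ * (R - dist w c) := by gcongr
        _ ≤ ‖deriv h p‖ * (R - dist p c) := h1
        _ = _ := by rw [htdef]; ring
    exact le_of_mul_le_mul_right h3 ht)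
  refine hno (h p) ((ball_subset_ball ?_).trans (hcov.trans (image_mono (hbs.trans hsub))))
  rw [htdef]
  nlinarith

/-- Schottky's theorem for the omitted values `0, 1`. -/
lemma nt_schottky01 (M : ℝ) : ∃ C : ℝ, ∀ (f : ℂ → ℂ) (c : ℂ) (R : ℝ), 0 < R →
    DifferentiableOn ℂ f (ball c (2 * R)) → (∀ z ∈ ball c (2 * R), f z ≠ 0 ∧ f z ≠ 1) →
    ‖f c‖ ≤ M → ∀ z ∈ closedBall c (R / 2), ‖f z‖ ≤ C := by
  obtain ⟨C, hC⟩ := (isCompact_closedBall (0 : ℂ)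
      (Real.pi + (Real.pi + (2 * M + 1)) + 288)).exists_bound_of_continuousOn
      (f := fun v => (1 + Complex.cos (Real.pi * Complex.cos v)) / 2) (by fun_prop)
  refine ⟨C, fun f c R hR hf hom hM z hz => ?_⟩
  have hpi : (Real.pi : ℂ) ≠ 0 := by exact_mod_cast Real.pi_ne_zero
  have hcb : c ∈ ball c (2 * R) := mem_ball_self (by linarith)
  obtain ⟨F, hF, hFc, hFn⟩ := nt_arccos (F := fun z => 2 * f z - 1) ((hf.const_mul 2).sub_const 1)
    (fun w hw h => (hom w hw).2 (by linear_combination h / 2))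
    (fun w hw h => (hom w hw).1 (by linear_combination h / 2)) (by linarith)
  have hFint : ∀ w ∈ ball c (2 * R), ∀ n : ℤ, F w ≠ n * Real.pi := by
    intro w hw n hn
    have h1 := hFc w hw
    rw [hn] at h1
    have h2 := Complex.sin_sq_add_cos_sq (n * Real.pi)
    rw [Complex.sin_int_mul_pi, h1] at h2
    have h3 : f w * (f w - 1) = 0 := by linear_combination h2 / 4
    rcases mul_eq_zero.1 h3 with h | h
    · exact (hom w hw).1 h
    · exact (hom w hw).2 (sub_eq_zero.1 h)
  obtain ⟨g, hg, hgc, hgn⟩ := nt_arccos (F := fun z => F z / Real.pi) (hF.div_const _)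
    (fun w hw h => hFint w hw 1 (by field_simp at h; simpa using h))
    (fun w hw h => hFint w hw (-1) (by field_simp at h; simpa using h)) (by linarith)
  have hno : ∀ w, ¬ ball w 6 ⊆ g '' ball c (2 * R) := by
    intro w hw
    obtain ⟨u, hu, n, hn⟩ := nt_net w
    obtain ⟨x, hx, rfl⟩ := hw hu
    refine hFint x hx n ?_
    have := hgc x hx
    rw [hn] at this
    field_simp at this
    exact this.symm
  have hbl := nt_bloch hR (by norm_num) hg hno
  have hsub : closedBall c (R / 2) ⊆ ball c (2 * R) := closedBall_subset_ball (by linarith)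
  have hmv := Convex.norm_image_sub_le_of_norm_deriv_le (𝕜 := ℂ) (f := g)
      (s := closedBall c (R / 2)) (C := 576 / R) (x := c) (y := z)
      (fun w hw => hg.differentiableAt (isOpen_ball.mem_nhds (hsub hw))) (by
        intro w hw
        have h1 := hbl w (closedBall_subset_closedBall (by linarith) hw)
        rw [mem_closedBall] at hw
        rw [le_div_iff₀ hR]
        nlinarith [norm_nonneg (deriv g w)]) (convex_closedBall _ _)
      (mem_closedBall_self (by linarith)) hz
  have hmv' : ‖g z - g c‖ ≤ 288 := by
    refine hmv.trans ?_
    rw [mem_closedBall, dist_eq_norm] at hz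
    calc 576 / R * ‖z - c‖ ≤ 576 / R * (R / 2) := by gcongr
      _ = 288 := by field_simp; norm_num
  have hFn' : ‖F c‖ ≤ Real.pi + (2 * M + 1) := by
    refine hFn.trans (add_le_add le_rfl ((norm_sub_le _ _).trans ?_))
    simp only [norm_mul, norm_one, Complex.norm_ofNat]
    linarith
  have hdiv : ‖F c / Real.pi‖ ≤ ‖F c‖ := by
    rw [norm_div, Complex.norm_real, Real.norm_of_nonneg Real.pi_pos.le]
    exact div_le_self (norm_nonneg _) (by linarith [Real.pi_gt_three])
  have hgz : ‖g z‖ ≤ Real.pi + (Real.pi + (2 * M + 1)) + 288 := by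
    have := norm_le_norm_add_norm_sub (g c) (g z)
    rw [norm_sub_rev] at this
    linarith
  have := hC (g z) (by simpa using hgz)
  have hfz : f z = (1 + Complex.cos (Real.pi * Complex.cos (g z))) / 2 := by
    rw [hgc z (hsub hz), mul_div_cancel₀ _ hpi, hFc z (hsub hz)]
    ring
  rw [hfz]; exact this

/-- Schottky's theorem for general omitted values. -/
lemma nt_schottky {a b : ℂ} (hab : a ≠ b) (M : ℝ) : ∃ C : ℝ, ∀ (f : ℂ → ℂ) (c : ℂ) (R : ℝ), 0 < R →
    DifferentiableOn ℂ f (ball c (2 * R)) → (∀ z ∈ ball c (2 * R), f z ≠ a ∧ f z ≠ b) →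
    ‖f c‖ ≤ M → ∀ z ∈ closedBall c (R / 2), ‖f z‖ ≤ C := by
  have hba : b - a ≠ 0 := sub_ne_zero.2 hab.symm
  have hba' : 0 < ‖b - a‖ := norm_pos_iff.2 hba
  obtain ⟨C, hC⟩ := nt_schottky01 ((M + ‖a‖) / ‖b - a‖)
  refine ⟨C * ‖b - a‖ + ‖a‖, fun f c R hR hf hom hM z hz => ?_⟩
  have := hC (fun z => (f z - a) / (b - a)) c R hR ((hf.sub_const a).div_const _) (by
    intro w hw
    refine ⟨div_ne_zero (sub_ne_zero.2 (hom w hw).1) hba, fun h => (hom w hw).2 ?_⟩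
    field_simp at h
    linear_combination h) (by
    rw [norm_div]
    gcongr
    exact (norm_sub_le _ _).trans (by linarith)) z hz
  rw [norm_div, div_le_iff₀ hba'] at this
  have h2 := norm_sub_norm_le (f z) a
  linarith

/-- Montel's theorem for locally uniformly bounded sequences. -/
lemma nt_montel {Ω : Set ℂ} (hΩ : IsOpen Ω) (F : ℕ → ℂ → ℂ)
    (hF : ∀ n, DifferentiableOn ℂ (F n) Ω)
    (hb : ∀ z ∈ Ω, ∃ r > 0, ball z r ⊆ Ω ∧ ∃ C, ∀ n, ∀ x ∈ ball z r, ‖F n x‖ ≤ C) :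
    ∃ φ : ℕ → ℕ, StrictMono φ ∧ ∃ g : ℂ → ℂ, DifferentiableOn ℂ g Ω ∧
        ∀ K ⊆ Ω, IsCompact K → TendstoUniformlyOn (fun k => F (φ k)) g atTop K := by
  classical
  have : LocallyCompactSpace Ω := hΩ.locallyCompactSpace
  let G : ℕ → C(Ω, ℂ) := fun n => ⟨fun z => F n z, (hF n).continuousOn.comp_continuous
    continuous_subtype_val (fun z => z.2)⟩
  have : T2Space (UniformOnFun Ω ℂ {K | IsCompact K}) :=
    UniformOnFun.t2Space_of_covering (eq_univ_iff_forall.mpr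
      (fun x ↦ mem_sUnion_of_mem (mem_singleton x) isCompact_singleton))
  have hcomp : IsCompact (closure (range G)) := by
    refine ArzelaAscoli.isCompact_closure_of_isClosedEmbedding (ι := C(Ω, ℂ))
      (F := fun f => (f : Ω → ℂ)) (𝔖 := {K | IsCompact K}) (fun K hK => hK)
      (ContinuousMap.isUniformEmbedding_toUniformOnFunIsCompact.isClosedEmbedding) ?_ ?_
    · intro K _
      refine Equicontinuous.equicontinuousOn ?_ K
      rintro ⟨z, hz⟩
      obtain ⟨r, hr, hrs, C, hC⟩ := hb z hz
      rw [Metric.equicontinuousAt_iff]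
      intro ε hε
      have hC0 : 0 ≤ C := (norm_nonneg _).trans (hC 0 z (mem_ball_self hr))
      refine ⟨min r (ε * r / (2 * C + 1)), by positivity, ?_⟩
      rintro ⟨x, hx⟩ hxz ⟨_, n, rfl⟩
      have hxz' : dist x z < min r (ε * r / (2 * C + 1)) := hxz
      have hxr : x ∈ ball z r := hxz'.trans_le (min_le_left _ _)
      have hsch := Complex.dist_le_div_mul_dist_of_mapsTo_ball (f := F n) (R₂ := 2 * C)
        ((hF n).mono hrs) (by
          intro w hw
          rw [mem_closedBall, dist_eq_norm]
          refine (norm_sub_le _ _).trans ?_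
          linarith [hC n w hw, hC n z (mem_ball_self hr)]) hxr
      have h2 : dist x z < ε * r / (2 * C + 1) := hxz'.trans_le (min_le_right _ _)
      rw [lt_div_iff₀ (by positivity)] at h2
      change dist (F n z) (F n x) < ε
      rw [dist_comm]
      refine hsch.trans_lt ?_
      rw [div_mul_eq_mul_div, div_lt_iff₀ hr]
      nlinarith [dist_nonneg (x := x) (y := z)]
    · rintro K _ ⟨z, hz⟩ _
      obtain ⟨r, hr, hrs, C, hC⟩ := hb z hz
      refine ⟨closedBall 0 C, isCompact_closedBall _ _, ?_⟩
      rintro _ ⟨n, rfl⟩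
      exact mem_closedBall_zero_iff.2 (hC n z (mem_ball_self hr))
  obtain ⟨g, -, φ, hφ, hlim⟩ := hcomp.tendsto_subseq (x := G) (fun n => subset_closure ⟨n, rfl⟩)
  rw [ContinuousMap.tendsto_iff_forall_isCompact_tendstoUniformlyOn] at hlim
  set g' : ℂ → ℂ := fun z => if h : z ∈ Ω then g ⟨z, h⟩ else 0 with hg'
  have hconv : ∀ K ⊆ Ω, IsCompact K → TendstoUniformlyOn (fun k => F (φ k)) g' atTop K := by
    intro K hK hKc
    have hK' : IsCompact ((Subtype.val : Ω → ℂ) ⁻¹' K) := by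
      rw [Topology.IsInducing.subtypeVal.isCompact_iff, Subtype.image_preimage_coe,
        inter_eq_right.2 hK]
      exact hKc
    have := hlim _ hK'
    rw [Metric.tendstoUniformlyOn_iff] at this ⊢
    intro ε hε
    filter_upwards [this ε hε] with k hk x hx
    have h1 := hk ⟨x, hK hx⟩ hx
    simp only [hg', dif_pos (hK hx)]
    exact h1
  refine ⟨φ, hφ, g', ?_, hconv⟩
  refine TendstoLocallyUniformlyOn.differentiableOn (F := fun k => F (φ k)) (φ := atTop) ?_
    (Eventually.of_forall fun k => hF _) hΩ
  rw [tendstoLocallyUniformlyOn_iff_forall_isCompact hΩ]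
  exact hconv


/-- **Normality theorem (Big Montel theorem).** A sequence of holomorphic functions on a
domain `Ω` omitting two fixed distinct values `a ≠ b` has a subsequence converging
uniformly on compact subsets of `Ω` to a holomorphic function, or a compactly divergent
subsequence. -/
theorem normality_theorem (Ω : Set ℂ) (hΩopen : IsOpen Ω) (hΩconn : IsConnected Ω)
    (a b : ℂ) (hab : a ≠ b) (F : ℕ → ℂ → ℂ)
    (hF : ∀ n, DifferentiableOn ℂ (F n) Ω)
    (havoid : ∀ n, ∀ z ∈ Ω, F n z ≠ a ∧ F n z ≠ b) :
    (∃ φ : ℕ → ℕ, StrictMono φ ∧ ∃ g : ℂ → ℂ, DifferentiableOn ℂ g Ω ∧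
        ∀ K ⊆ Ω, IsCompact K →
          TendstoUniformlyOn (fun k => F (φ k)) g atTop K) ∨
    (∃ φ : ℕ → ℕ, StrictMono φ ∧ ∀ K ⊆ Ω, IsCompact K → ∀ L : Set ℂ, IsCompact L →
        ∃ N : ℕ, ∀ k > N, F (φ k) '' K ∩ L = ∅) := by
  classical
  -- local Harnack-type principle coming from Schottky's theorem
  have hloc : ∀ z ∈ Ω, ∃ r > 0, ball z r ⊆ Ω ∧ ∀ M : ℝ, ∃ C : ℝ, ∀ n, ∀ x ∈ ball z r,
      ∀ y ∈ ball z r, ‖F n x‖ ≤ M → ‖F n y‖ ≤ C := by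
    intro z hz
    obtain ⟨ε, hε, hεs⟩ := Metric.isOpen_iff.1 hΩopen z hz
    refine ⟨ε / 20, by positivity, (ball_subset_ball (by linarith)).trans hεs, fun M => ?_⟩
    obtain ⟨C, hC⟩ := nt_schottky hab M
    refine ⟨C, fun n x hx y hy hM => ?_⟩
    rw [mem_ball] at hx hy
    have hs : ball x (2 * (ε / 4)) ⊆ Ω :=
      (ball_subset_ball' (by linarith)).trans hεs
    refine hC (F n) x (ε / 4) (by positivity) ((hF n).mono hs)
      (fun w hw => havoid n w (hs hw)) hM y ?_
    rw [mem_closedBall]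
    linarith [dist_triangle_right y x z]
  have hglob : ∀ x ∈ Ω, ∀ y ∈ Ω, ∀ M : ℝ, ∃ C : ℝ, ∀ n, ‖F n x‖ ≤ M → ‖F n y‖ ≤ C := by
    intro x hx y hy
    refine hΩconn.isPreconnected.induction₂'
      (fun x y => ∀ M : ℝ, ∃ C : ℝ, ∀ n, ‖F n x‖ ≤ M → ‖F n y‖ ≤ C) ?_ ?_ hx hy
    · intro z hz
      obtain ⟨r, hr, -, h⟩ := hloc z hz
      filter_upwards [mem_nhdsWithin_of_mem_nhds (ball_mem_nhds z hr)] with w hw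
      refine ⟨fun M => ?_, fun M => ?_⟩
      · obtain ⟨C, hC⟩ := h M
        exact ⟨C, fun n => hC n z (mem_ball_self hr) w hw⟩
      · obtain ⟨C, hC⟩ := h M
        exact ⟨C, fun n => hC n w hw z (mem_ball_self hr)⟩
    · intro x y z _ _ _ h1 h2 M
      obtain ⟨C, hC⟩ := h1 M
      obtain ⟨D, hD⟩ := h2 C
      exact ⟨D, fun n hn => hD n (hC n hn)⟩
  obtain ⟨z₀, hz₀⟩ := hΩconn.nonempty
  by_cases hdiv : Tendsto (fun n => ‖F n z₀‖) atTop atTop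
  · right
    refine ⟨id, strictMono_id, fun K hK hKc L hL => ?_⟩
    obtain ⟨M, hM⟩ := hL.isBounded.exists_norm_le
    have key : ∀ᶠ n in atTop, ∀ x ∈ K, M < ‖F n x‖ := by
      refine hKc.induction_on (p := fun K => ∀ᶠ n in atTop, ∀ x ∈ K, M < ‖F n x‖) ?_ ?_ ?_ ?_
      · simp
      · intro s t hst ht
        filter_upwards [ht] with n hn x hx using hn x (hst hx)
      · intro s t hs ht
        filter_upwards [hs, ht] with n h1 h2 x hx
        exact hx.elim (h1 x) (h2 x)
      · intro z hz
        obtain ⟨r, hr, -, h⟩ := hloc z (hK hz)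
        obtain ⟨C, hC⟩ := h M
        obtain ⟨D, hD⟩ := hglob z (hK hz) z₀ hz₀ C
        refine ⟨ball z r, mem_nhdsWithin_of_mem_nhds (ball_mem_nhds z hr), ?_⟩
        filter_upwards [hdiv.eventually_gt_atTop D] with n hn x hx
        by_contra hle
        push Not at hle
        exact absurd (hD n (hC n x hx z (mem_ball_self hr) hle)) (not_le.2 hn)
    obtain ⟨N, hN⟩ := eventually_atTop.1 key
    refine ⟨N, fun k hk => ?_⟩
    rw [Set.eq_empty_iff_forall_notMem]
    rintro _ ⟨⟨x, hx, rfl⟩, hxL⟩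
    exact absurd (hM _ hxL) (not_le.2 (hN k hk.le x hx))
  · left
    rw [Filter.tendsto_atTop] at hdiv
    push Not at hdiv
    obtain ⟨M, hM⟩ := hdiv
    have hM' : ∃ᶠ n in atTop, ‖F n z₀‖ ≤ M := by
      have h2 : ∃ᶠ n in atTop, ¬ M ≤ ‖F n z₀‖ := by simpa using hM
      exact h2.mono fun n hn => (not_le.1 hn).le
    obtain ⟨φ, hφ, hφM⟩ := extraction_of_frequently_atTop hM'
    obtain ⟨ψ, hψ, g, hg, hconv⟩ := nt_montel hΩopen (fun k => F (φ k)) (fun k => hF _) (by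
      intro z hz
      obtain ⟨r, hr, hrs, h⟩ := hloc z hz
      obtain ⟨C, hC⟩ := hglob z₀ hz₀ z hz M
      obtain ⟨D, hD⟩ := h C
      exact ⟨r, hr, hrs, D, fun n x hx =>
        hD (φ n) z (mem_ball_self hr) x hx (hC (φ n) (hφM n))⟩)
    exact ⟨φ ∘ ψ, hφ.comp hψ, g, hg, hconv⟩
end
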